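/- Define b(n) = ∑_{d | n} (μ * a)(d) · d/φ(d) for a multiplicative-type setup where a : ℕ → ℂ satisfies a(1) = 1 and |a(n)| ≪ n^{−α} with α > 0. Then ∑_{n ≥ 1} |b(n)| (log n)/n < ∞, and by Möbius inversion (μ * a)(n)/φ(n) = (μ * b)(n)/n for all n ≥ 1. -/

import Mathlib

open scoped Classical
open Finset Filter

/-- The Dirichlet convolution `(μ * a)(n) = ∑_{d | n} μ(d) a(n/d)`. -/
noncomputable def muConv (a : ℕ → ℂ) (n : ℕ) : ℂ :=
  ∑ d ∈ n.divisors, (ArithmeticFunction.moebius d : ℂ) * a (n / d)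

/-- `b(n) = ∑_{d | n} (μ * a)(d) · d/φ(d)`. -/
noncomputable def bFun (a : ℕ → ℂ) (n : ℕ) : ℂ :=
  ∑ d ∈ n.divisors, muConv a d * ((d : ℂ) / (Nat.totient d : ℂ))


/-- Multiplicative functions `n^{-t} ∏_{p ∣ n} w p` are summable when `w p ≤ 2 p^{-u}`. -/
lemma summable_aux (w : ℕ → ℝ) (t u : ℝ) (ht : 0 < t) (htu : 1 < u + t)
    (hw0 : ∀ p, p.Prime → 0 ≤ w p) (hw : ∀ p, p.Prime → w p ≤ 2 * (p : ℝ) ^ (-u)) :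
    Summable (fun n : ℕ => (n : ℝ) ^ (-t) * ∏ p ∈ n.primeFactors, w p) := by
  set f : ℕ → ℝ := fun n : ℕ => (n : ℝ) ^ (-t) * ∏ p ∈ n.primeFactors, w p with hf
  have hf0 : ∀ n, 0 ≤ f n := fun n =>
    mul_nonneg (Real.rpow_nonneg n.cast_nonneg _)
      (prod_nonneg fun p hp => hw0 p (Nat.prime_of_mem_primeFactors hp))
  have hfz : f 0 = 0 := by simp [hf, ht.ne']
  have hf1 : f 1 = 1 := by simp [hf]
  have hmul : ∀ {m n : ℕ}, Nat.Coprime m n → f (m * n) = f m * f n := by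
    intro m n h
    simp only [hf]
    rw [h.primeFactors_mul, prod_union h.disjoint_primeFactors, Nat.cast_mul,
      Real.mul_rpow m.cast_nonneg n.cast_nonneg]
    ring
  set q : ℕ → ℝ := fun p => (p : ℝ) ^ (-t) with hq
  have hq0 : ∀ p, 0 ≤ q p := fun p => Real.rpow_nonneg p.cast_nonneg _
  have hq2 : q 2 < 1 := Real.rpow_lt_one_of_one_lt_of_neg (by norm_num) (by linarith)
  have hqle : ∀ p : ℕ, p.Prime → q p ≤ q 2 := fun p hp =>
    Real.rpow_le_rpow_of_nonpos (by norm_num) (by exact_mod_cast hp.two_le) (by linarith)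
  have hpow : ∀ p : ℕ, p.Prime → ∀ k : ℕ, f (p ^ (k + 1)) = (w p * q p) * q p ^ k := by
    intro p hp k
    simp only [hf, hq]
    rw [Nat.primeFactors_prime_pow (Nat.succ_ne_zero k) hp, prod_singleton, Nat.cast_pow,
      ← Real.rpow_natCast, ← Real.rpow_mul p.cast_nonneg, mul_comm ((k + 1 : ℕ) : ℝ),
      Real.rpow_mul p.cast_nonneg, Real.rpow_natCast, pow_succ]
    ring
  have hs1 : ∀ p : ℕ, p.Prime → Summable (fun k : ℕ => f (p ^ (k + 1))) := by
    intro p hp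
    simp only [hpow p hp]
    exact (summable_geometric_of_lt_one (hq0 p) ((hqle p hp).trans_lt hq2)).mul_left _
  have hs : ∀ p : ℕ, p.Prime → Summable (fun k : ℕ => f (p ^ k)) := fun p hp =>
    (summable_nat_add_iff 1).1 (hs1 p hp)
  set K : ℝ := 2 * (1 - q 2)⁻¹ with hK
  have hK0 : 0 ≤ K := by
    have : 0 < 1 - q 2 := by linarith
    positivity
  have hS : Summable (fun p : ℕ => K * (p : ℝ) ^ (-(u + t))) :=
    (Real.summable_nat_rpow.2 (by linarith)).mul_left K
  have hS0 : ∀ p : ℕ, 0 ≤ K * (p : ℝ) ^ (-(u + t)) := fun p =>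
    mul_nonneg hK0 (Real.rpow_nonneg p.cast_nonneg _)
  have hloc : ∀ p : ℕ, p.Prime → ∑' k, f (p ^ k) ≤ 1 + K * (p : ℝ) ^ (-(u + t)) := by
    intro p hp
    have hp0 : (0 : ℝ) < p := by exact_mod_cast hp.pos
    rw [(hs p hp).tsum_eq_zero_add]
    simp only [hpow p hp, pow_zero, hf1, tsum_mul_left]
    rw [tsum_geometric_of_lt_one (hq0 p) ((hqle p hp).trans_lt hq2)]
    have h1 : (1 - q p)⁻¹ ≤ (1 - q 2)⁻¹ :=
      inv_anti₀ (by linarith) (by linarith [hqle p hp])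
    have h2 : w p * q p ≤ 2 * (p : ℝ) ^ (-(u + t)) := by
      calc w p * q p ≤ 2 * (p : ℝ) ^ (-u) * q p :=
            mul_le_mul_of_nonneg_right (hw p hp) (hq0 p)
        _ = 2 * (p : ℝ) ^ (-(u + t)) := by
            rw [neg_add, Real.rpow_add hp0]; ring
    have h3 : 0 ≤ (1 - q p)⁻¹ := inv_nonneg.2 (by linarith [hqle p hp])
    have h4 : w p * q p * (1 - q p)⁻¹ ≤ 2 * (p : ℝ) ^ (-(u + t)) * (1 - q 2)⁻¹ :=
      mul_le_mul h2 h1 h3 (by positivity)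
    rw [hK]
    linarith
  refine summable_of_sum_range_le (c := Real.exp (∑' p : ℕ, K * (p : ℝ) ^ (-(u + t)))) hf0 ?_
  intro N
  obtain ⟨-, hE⟩ := EulerProduct.summable_and_hasSum_smoothNumbers_prod_primesBelow_tsum
    (f := f) hf1 hmul (fun {p} hp => by
      simpa only [Real.norm_of_nonneg (hf0 _)] using hs p hp) N
  have hE' := (hasSum_subtype_iff_indicator (f := f) (s := N.smoothNumbers)).1 hE
  calc ∑ i ∈ range N, f i = ∑ i ∈ range N, (N.smoothNumbers).indicator f i := by
        refine sum_congr rfl fun i hi => ?_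
        rcases Nat.eq_zero_or_pos i with rfl | hpos
        · rw [Set.indicator_apply, hfz]; simp
        · rw [Set.indicator_of_mem (Nat.mem_smoothNumbers_of_lt hpos (mem_range.1 hi))]
    _ ≤ ∏ p ∈ N.primesBelow, ∑' n : ℕ, f (p ^ n) :=
        sum_le_hasSum _ (fun i _ => Set.indicator_nonneg (fun _ _ => hf0 _) _) hE'
    _ ≤ ∏ p ∈ N.primesBelow, (1 + K * (p : ℝ) ^ (-(u + t))) :=
        prod_le_prod (fun p _ => tsum_nonneg fun _ => hf0 _)
          (fun p hp => hloc p (Nat.prime_of_mem_primesBelow hp))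
    _ ≤ Real.exp (∑ p ∈ N.primesBelow, K * (p : ℝ) ^ (-(u + t))) :=
        Real.prod_one_add_le_exp_sum _ hS0
    _ ≤ _ := Real.exp_le_exp.2 (hS.sum_le_tsum _ fun p _ => hS0 p)

lemma self_div_totient (n : ℕ) (hn : n ≠ 0) :
    (n : ℝ) / (Nat.totient n : ℝ) = ∏ p ∈ n.primeFactors, (p : ℝ) / ((p : ℝ) - 1) := by
  have h := Nat.totient_mul_prod_primeFactors n
  have h' : (Nat.totient n : ℝ) * ∏ p ∈ n.primeFactors, (p : ℝ)
      = n * ∏ p ∈ n.primeFactors, ((p : ℝ) - 1) := by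
    have h2 : ((Nat.totient n * ∏ p ∈ n.primeFactors, p : ℕ) : ℝ)
      = ((n * ∏ p ∈ n.primeFactors, (p - 1) : ℕ) : ℝ) := by rw [h]
    push_cast at h2
    rw [h2]
    congr 1
    refine prod_congr rfl fun p hp => ?_
    rw [Nat.cast_sub (Nat.prime_of_mem_primeFactors hp).one_le, Nat.cast_one]
  rw [prod_div_distrib, div_eq_div_iff, ← h', mul_comm]
  · have := Nat.totient_pos.2 (Nat.pos_of_ne_zero hn)
    positivity
  · refine prod_ne_zero_iff.2 fun p hp => ?_
    have : (1 : ℝ) < p := by exact_mod_cast (Nat.prime_of_mem_primeFactors hp).one_lt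
    linarith

lemma sum_moebius_prod (r : ℕ → ℝ) (m : ℕ) (hm : m ≠ 0) :
    ∑ e ∈ m.divisors, (ArithmeticFunction.moebius e : ℝ) * ∏ p ∈ e.primeFactors, r p
      = ∏ p ∈ m.primeFactors, (1 - r p) := by
  have h1 : ∑ e ∈ m.divisors, (ArithmeticFunction.moebius e : ℝ) * ∏ p ∈ e.primeFactors, r p
      = ∑ e ∈ m.divisors with Squarefree e,
        (ArithmeticFunction.moebius e : ℝ) * ∏ p ∈ e.primeFactors, r p := by
    rw [sum_filter]
    refine sum_congr rfl fun e _ => ?_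
    split_ifs with h
    · rfl
    · simp [ArithmeticFunction.moebius_eq_zero_of_not_squarefree h]
  have h2 : (UniqueFactorizationMonoid.normalizedFactors m).toFinset = m.primeFactors := by
    rw [Nat.factors_eq]; rfl
  have h3 := Nat.sum_divisors_filter_squarefree hm
    (f := fun e => (ArithmeticFunction.moebius e : ℝ) * ∏ p ∈ e.primeFactors, r p)
  rw [h2] at h3
  have h4 : ∏ p ∈ m.primeFactors, (1 - r p) = ∏ p ∈ m.primeFactors, (1 + -r p) := by
    simp [sub_eq_add_neg]
  rw [h1, h4, prod_one_add]
  convert h3 using 1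
  refine sum_congr rfl fun T hT => ?_
  have hTp : ∀ p ∈ T, p.Prime := fun p hp =>
    Nat.prime_of_mem_primeFactors (mem_powerset.1 hT hp)
  have hT1 : T.val.prod = ∏ p ∈ T, p := by rw [prod_val]; rfl
  have hpf : (∏ p ∈ T, p).primeFactors = T := Nat.primeFactors_prod hTp
  have hmu : (ArithmeticFunction.moebius (∏ p ∈ T, p)) = (-1) ^ T.card := by
    rw [ArithmeticFunction.isMultiplicative_moebius.map_prod_of_prime T hTp,
      prod_congr rfl fun p hp => ArithmeticFunction.moebius_apply_prime (hTp p hp), prod_const]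
  rw [hT1, hpf, hmu, prod_neg]
  push_cast
  ring

lemma kernel_bound (d m : ℕ) (hd : d ≠ 0) (hm : m ≠ 0) :
    |∑ e ∈ m.divisors, (ArithmeticFunction.moebius e : ℝ) *
        (((d * e : ℕ) : ℝ) / (Nat.totient (d * e) : ℝ))|
      ≤ (∏ p ∈ d.primeFactors, (p : ℝ) / ((p : ℝ) - 1)) *
        ∏ p ∈ m.primeFactors, ((p : ℝ) - 1)⁻¹ := by
  set v : ℕ → ℝ := fun p => (p : ℝ) / ((p : ℝ) - 1) with hv
  set r : ℕ → ℝ := fun p => if p ∈ d.primeFactors then 1 else v p with hr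
  have h1 : ∀ e ∈ m.divisors, (ArithmeticFunction.moebius e : ℝ) *
        (((d * e : ℕ) : ℝ) / (Nat.totient (d * e) : ℝ))
      = (∏ p ∈ d.primeFactors, v p) *
        ((ArithmeticFunction.moebius e : ℝ) * ∏ p ∈ e.primeFactors, r p) := by
    intro e he
    have he0 : e ≠ 0 := (Nat.pos_of_mem_divisors he).ne'
    rw [self_div_totient _ (mul_ne_zero hd he0), Nat.primeFactors_mul hd he0,
      ← union_sdiff_self_eq_union, prod_union disjoint_sdiff]
    have : ∏ p ∈ e.primeFactors, r p = ∏ p ∈ e.primeFactors \ d.primeFactors, v p := by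
      rw [sdiff_eq_filter, prod_filter]
      refine prod_congr rfl fun p _ => ?_
      simp only [hr]
      split_ifs <;> simp_all
    rw [this]; ring
  have hv0 : ∀ (n : ℕ), ∀ p ∈ n.primeFactors, (1 : ℝ) < p := fun n p hp => by
    exact_mod_cast (Nat.prime_of_mem_primeFactors hp).one_lt
  have hA : 0 ≤ ∏ p ∈ d.primeFactors, v p := prod_nonneg fun p hp => by
    have := hv0 d p hp
    exact div_nonneg (by linarith) (by linarith)
  rw [sum_congr rfl h1, ← mul_sum, sum_moebius_prod r m hm, abs_mul, abs_of_nonneg hA]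
  refine mul_le_mul_of_nonneg_left ?_ hA
  rw [abs_prod]
  refine prod_le_prod (fun _ _ => abs_nonneg _) fun p hp => ?_
  have hp1 := hv0 m p hp
  have hp2 : (0 : ℝ) < p - 1 := by linarith
  simp only [hr]
  split_ifs
  · simp [hp2.le]
  · have : 1 - v p = -((p : ℝ) - 1)⁻¹ := by
      simp only [hv]; field_simp; ring
    rw [this, abs_neg, abs_of_pos (inv_pos.2 hp2)]

lemma bFun_eq (a : ℕ → ℂ) (n : ℕ) :
    bFun a n = ∑ x ∈ n.divisorsAntidiagonal, a x.1 *
      ((∑ e ∈ x.2.divisors, (ArithmeticFunction.moebius e : ℝ) *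
        (((x.1 * e : ℕ) : ℝ) / (Nat.totient (x.1 * e) : ℝ)) : ℝ) : ℂ) := by
  have h1 : bFun a n = ∑ x ∈ n.divisorsAntidiagonal, ∑ y ∈ x.1.divisorsAntidiagonal,
      (ArithmeticFunction.moebius y.1 : ℂ) * a y.2 *
        (((y.2 * y.1 : ℕ) : ℂ) / (Nat.totient (y.2 * y.1) : ℂ)) := by
    rw [Nat.sum_divisorsAntidiagonal (fun i _ => ∑ y ∈ i.divisorsAntidiagonal,
      (ArithmeticFunction.moebius y.1 : ℂ) * a y.2 *
        (((y.2 * y.1 : ℕ) : ℂ) / (Nat.totient (y.2 * y.1) : ℂ)))]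
    unfold bFun muConv
    refine sum_congr rfl fun d _ => ?_
    rw [← Nat.sum_divisorsAntidiagonal (fun i j => (ArithmeticFunction.moebius i : ℂ) * a j),
      sum_mul]
    refine sum_congr rfl fun y hy => ?_
    rw [mul_comm y.2, (Nat.mem_divisorsAntidiagonal.1 hy).1]
  have h2 : ∀ x ∈ n.divisorsAntidiagonal, a x.1 *
      ((∑ e ∈ x.2.divisors, (ArithmeticFunction.moebius e : ℝ) *
        (((x.1 * e : ℕ) : ℝ) / (Nat.totient (x.1 * e) : ℝ)) : ℝ) : ℂ)
      = ∑ y ∈ x.2.divisorsAntidiagonal, (ArithmeticFunction.moebius y.1 : ℂ) * a x.1 *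
        (((x.1 * y.1 : ℕ) : ℂ) / (Nat.totient (x.1 * y.1) : ℂ)) := by
    intro x _
    rw [Nat.sum_divisorsAntidiagonal (fun i _ => (ArithmeticFunction.moebius i : ℂ) * a x.1 *
        (((x.1 * i : ℕ) : ℂ) / (Nat.totient (x.1 * i) : ℂ)))]
    push_cast
    rw [mul_sum]
    exact sum_congr rfl fun e _ => by ring
  rw [h1, sum_congr rfl h2, sum_sigma', sum_sigma']
  refine sum_nbij' (fun ⟨⟨_i, j⟩, ⟨k, l⟩⟩ ↦ ⟨(l, k * j), (k, j)⟩)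
    (fun ⟨⟨i, _j⟩, ⟨k, l⟩⟩ ↦ ⟨(k * i, l), (k, i)⟩) ?_ ?_ ?_ ?_ ?_
  · rintro ⟨⟨i, j⟩, ⟨k, l⟩⟩ h
    simp only [mem_sigma, Nat.mem_divisorsAntidiagonal] at h ⊢
    obtain ⟨⟨rfl, h0⟩, rfl, h1⟩ := h
    simp_all
    ring
  · rintro ⟨⟨i, j⟩, ⟨k, l⟩⟩ h
    simp only [mem_sigma, Nat.mem_divisorsAntidiagonal] at h ⊢
    obtain ⟨⟨rfl, h0⟩, rfl, h1⟩ := h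
    simp_all
    ring
  · rintro ⟨⟨i, j⟩, ⟨k, l⟩⟩ h
    simp only [mem_sigma, Nat.mem_divisorsAntidiagonal] at h ⊢
    obtain ⟨⟨rfl, h0⟩, rfl, h1⟩ := h
    rfl
  · rintro ⟨⟨i, j⟩, ⟨k, l⟩⟩ h
    simp only [mem_sigma, Nat.mem_divisorsAntidiagonal] at h ⊢
    obtain ⟨⟨rfl, h0⟩, rfl, h1⟩ := h
    rfl
  · rintro ⟨⟨i, j⟩, ⟨k, l⟩⟩ h
    rfl

lemma summable_antidiag (F G : ℕ → ℝ) (hF0 : ∀ n, 0 ≤ F n) (hG0 : ∀ n, 0 ≤ G n)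
    (hF : Summable F) (hG : Summable G) :
    Summable (fun n : ℕ => ∑ x ∈ n.divisorsAntidiagonal, F x.1 * G x.2) := by
  have hFG : Summable (fun x : ℕ × ℕ => F x.1 * G x.2) :=
    hF.mul_of_nonneg hG hF0 hG0
  have h0 : ∀ x : ℕ × ℕ, 0 ≤ F x.1 * G x.2 := fun x => mul_nonneg (hF0 _) (hG0 _)
  refine summable_of_sum_range_le (c := ∑' x : ℕ × ℕ, F x.1 * G x.2)
    (fun n => sum_nonneg fun x _ => h0 x) fun N => ?_
  rw [← sum_biUnion]
  · exact hFG.sum_le_tsum _ fun x _ => h0 x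
  · intro i _ j _ hij
    refine disjoint_left.2 fun x hx hy => hij ?_
    rw [← (Nat.mem_divisorsAntidiagonal.1 hx).1, (Nat.mem_divisorsAntidiagonal.1 hy).1]

/-- The key step of Corollary 1.3 over ℕ: with `a(1) = 1` and `|a(n)| ≪ n^{−α}`, `α > 0`,
the function `b(n) = ∑_{d|n} (μ*a)(d)·d/φ(d)` satisfies `∑ |b(n)| log n / n < ∞`, and by
Möbius inversion `(μ*a)(n)/φ(n) = (μ*b)(n)/n` for all `n ≥ 1`. -/
theorem bFun_summable_and_inversion (a : ℕ → ℂ) (ha1 : a 1 = 1)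
    (α C : ℝ) (hα : 0 < α) (hdecay : ∀ n : ℕ, 1 ≤ n → ‖a n‖ ≤ C * (n : ℝ) ^ (-α)) :
    Summable (fun n : ℕ =>
      if 1 ≤ n then ‖bFun a n‖ * Real.log n / n else 0) ∧
    ∀ n : ℕ, 1 ≤ n →
      muConv a n / (Nat.totient n : ℂ) = muConv (bFun a) n / (n : ℂ) := by
  constructor
  · have hC : 0 ≤ C := by
      have h := hdecay 1 le_rfl
      rw [ha1] at h
      simp at h
      linarith
    set ε : ℝ := min α 1 / 2 with hε
    have hε0 : 0 < ε := by have := lt_min hα one_pos; positivity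
    have hεα : ε < α := by
      have := min_le_left α 1; rw [hε]; linarith
    have hε1 : ε < 1 := by
      have := min_le_right α 1; rw [hε]; linarith
    have hp2 : ∀ p : ℕ, p.Prime → (2 : ℝ) ≤ p := fun p hp => by exact_mod_cast hp.two_le
    set v : ℕ → ℝ := fun p => (p : ℝ) / ((p : ℝ) - 1) with hv
    set w : ℕ → ℝ := fun p => ((p : ℝ) - 1)⁻¹ with hw
    have hv0 : ∀ p : ℕ, p.Prime → 0 ≤ v p := fun p hp =>
      div_nonneg (by linarith [hp2 p hp]) (by linarith [hp2 p hp])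
    have hw0 : ∀ p : ℕ, p.Prime → 0 ≤ w p := fun p hp =>
      inv_nonneg.2 (by linarith [hp2 p hp])
    set F : ℕ → ℝ := fun n => (n : ℝ) ^ (-(1 + α - ε)) * ∏ p ∈ n.primeFactors, v p with hF
    set G : ℕ → ℝ := fun n => (n : ℝ) ^ (-(1 - ε)) * ∏ p ∈ n.primeFactors, w p with hG
    have hFs : Summable F := by
      refine summable_aux v (1 + α - ε) 0 (by linarith) (by linarith) hv0 fun p hp => ?_
      have := hp2 p hp
      simp only [hv, neg_zero, Real.rpow_zero, mul_one]
      rw [div_le_iff₀ (by linarith)]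
      linarith
    have hGs : Summable G := by
      refine summable_aux w (1 - ε) 1 (by linarith) (by linarith) hw0 fun p hp => ?_
      have := hp2 p hp
      simp only [hw, Real.rpow_neg_one]
      rw [inv_le_iff_one_le_mul₀ (by linarith), mul_assoc, inv_mul_eq_div, mul_div_assoc',
        le_div_iff₀ (by linarith)]
      linarith
    have hF0 : ∀ n, 0 ≤ F n := fun n => mul_nonneg (Real.rpow_nonneg n.cast_nonneg _)
      (prod_nonneg fun p hp => hv0 p (Nat.prime_of_mem_primeFactors hp))
    have hG0 : ∀ n, 0 ≤ G n := fun n => mul_nonneg (Real.rpow_nonneg n.cast_nonneg _)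
      (prod_nonneg fun p hp => hw0 p (Nat.prime_of_mem_primeFactors hp))
    refine Summable.of_nonneg_of_le ?_ ?_
      ((summable_antidiag F G hF0 hG0 hFs hGs).mul_left (C / ε))
    · intro n
      split_ifs with h
      · have := Real.log_natCast_nonneg n
        positivity
      · rfl
    · intro n
      split_ifs with h
      · have hn0 : (0 : ℝ) < n := by exact_mod_cast h
        have hlog : Real.log n / n ≤ (n : ℝ) ^ (-(1 - ε)) / ε := by
          have h1 := Real.log_le_rpow_div hn0.le hε0
          calc Real.log n / n ≤ (n : ℝ) ^ ε / ε / n := by gcongr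
            _ = (n : ℝ) ^ (-(1 - ε)) / ε := by
              rw [neg_sub, Real.rpow_sub hn0, Real.rpow_one]; ring
        have hb : ‖bFun a n‖ ≤ ∑ x ∈ n.divisorsAntidiagonal, C * (x.1 : ℝ) ^ (-α) *
            ((∏ p ∈ x.1.primeFactors, v p) * ∏ p ∈ x.2.primeFactors, w p) := by
          rw [bFun_eq]
          refine (norm_sum_le _ _).trans (sum_le_sum fun x hx => ?_)
          have hx1 := Nat.left_ne_zero_of_mem_divisorsAntidiagonal hx
          have hx2 := Nat.right_ne_zero_of_mem_divisorsAntidiagonal hx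
          rw [norm_mul, Complex.norm_real, Real.norm_eq_abs]
          exact mul_le_mul (hdecay _ (Nat.one_le_iff_ne_zero.2 hx1)) (kernel_bound _ _ hx1 hx2)
            (abs_nonneg _) (mul_nonneg hC (Real.rpow_nonneg (Nat.cast_nonneg _) _))
        calc ‖bFun a n‖ * Real.log n / n = ‖bFun a n‖ * (Real.log n / n) := by ring
          _ ≤ (∑ x ∈ n.divisorsAntidiagonal, C * (x.1 : ℝ) ^ (-α) *
            ((∏ p ∈ x.1.primeFactors, v p) * ∏ p ∈ x.2.primeFactors, w p)) *
              ((n : ℝ) ^ (-(1 - ε)) / ε) :=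
            mul_le_mul hb hlog (div_nonneg (Real.log_natCast_nonneg n) hn0.le)
              ((norm_nonneg _).trans hb)
          _ = C / ε * ∑ x ∈ n.divisorsAntidiagonal, F x.1 * G x.2 := by
            rw [sum_mul, mul_sum]
            refine sum_congr rfl fun x hx => ?_
            have hx1 : (0 : ℝ) < x.1 := by
              exact_mod_cast Nat.pos_of_ne_zero (Nat.left_ne_zero_of_mem_divisorsAntidiagonal hx)
            have hx3 : (n : ℝ) = x.1 * x.2 := by
              exact_mod_cast (Nat.mem_divisorsAntidiagonal.1 hx).1.symm
            have hx4 : (x.1 : ℝ) ^ (-(1 + α - ε)) = (x.1 : ℝ) ^ (-α) * (x.1 : ℝ) ^ (-(1 - ε)) := by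
              rw [← Real.rpow_add hx1]; congr 1; ring
            simp only [hF, hG]
            rw [hx3, Real.mul_rpow hx1.le (Nat.cast_nonneg _), hx4]
            ring
      · exact mul_nonneg (div_nonneg hC hε0.le)
          (sum_nonneg fun x _ => mul_nonneg (hF0 _) (hG0 _))
  · intro n hn
    have h := (ArithmeticFunction.sum_eq_iff_sum_mul_moebius_eq
      (f := fun d => muConv a d * ((d : ℂ) / (Nat.totient d : ℂ))) (g := bFun a)).1
      (fun n _ => rfl) n hn
    have h2 : muConv (bFun a) n = muConv a n * ((n : ℂ) / (Nat.totient n : ℂ)) := by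
      rw [← h]
      unfold muConv
      rw [Nat.sum_divisorsAntidiagonal
        (fun i j => (ArithmeticFunction.moebius i : ℂ) * bFun a j)]
    have hn0 : (n : ℂ) ≠ 0 := by exact_mod_cast (Nat.pos_of_ne_zero (by omega)).ne'
    rw [h2]
    field_simp
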